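/- arXiv:1901.05329 — 2 statements merged into one kernel-verified Lean document; each statement's English description precedes it below -/
import Mathlib

section
/- Let q be a complex number with 0 < |q| < 1 and let b be a complex number with 1 + b q^N ≠ 0 for every positive integer N. Then for all positive integers m and n, the absolutely convergent sum over all n-tuples (a_1, …, a_n) of nonnegative integers with a_1 ≤ a_2 ≤ ⋯ ≤ a_n of q^{m(a_1 + a_2 + ⋯ + a_n)} / ∏_{j=1}^{n} ∏_{k=ε_j}^{m} (1 + b q^{(j−1)m + k + a_j}) equals 1 / ((q^m; q^m)_n · (−bq; q)_{mn}), where ε_1 = 1 if a_1 = 0 and ε_1 = 0 otherwise, and for 2 ≤ j ≤ n, ε_j = 1 if a_j = a_{j−1} and ε_j = 0 otherwise. -/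
/-- The finite q-Pochhammer symbol `(a; q)_n = ∏_{j=0}^{n-1} (1 - a q^j)`. -/
noncomputable def qPoch (a q : ℂ) (n : ℕ) : ℂ := ∏ j ∈ Finset.range n, (1 - a * q ^ j)

/-- The lower limit `ε_j` of the inner product in Lemma 3.3: `ε_1 = 1` if
`a_1 = 0` and `ε_1 = 0` otherwise; for `j ≥ 2`, `ε_j = 1` if `a_j = a_{j-1}`
and `ε_j = 0` otherwise. -/
def eps5 {n : ℕ} (a : Fin n → ℕ) (j : Fin n) : ℕ :=
  if h : (j : ℕ) = 0 then (if a j = 0 then 1 else 0)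
  else if a j = a ⟨(j : ℕ) - 1,
      lt_trans (Nat.sub_lt (Nat.pos_of_ne_zero h) one_pos) j.isLt⟩ then 1 else 0

open Filter Topology in
/-- The reciprocals of the factors `1 + b q ^ N`, `N > 0`, are uniformly bounded. -/
lemma exists_norm_inv_one_add_mul_pow_le {q : ℂ} (hq1 : ‖q‖ < 1) (b : ℂ) :
    ∃ B : ℝ, 1 ≤ B ∧ ∀ N : ℕ, 0 < N → ‖(1 + b * q ^ N)⁻¹‖ ≤ B := by
  have h0 : Tendsto (fun N : ℕ => 1 + b * q ^ (N + 1)) atTop (𝓝 1) := by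
    have h := (tendsto_pow_atTop_nhds_zero_of_norm_lt_one hq1).comp (tendsto_add_atTop_nat 1)
    simpa using (h.const_mul b).const_add 1
  obtain ⟨B, hB⟩ := (h0.inv₀ one_ne_zero).norm.bddAbove_range
  refine ⟨max B 1, le_max_right _ _, fun N hN => le_max_of_le_left ?_⟩
  obtain ⟨k, rfl⟩ := Nat.exists_eq_add_of_lt hN
  exact hB ⟨k, by simp⟩

/-- A weakly increasing tuple of length `n + 1` is its first entry together with the weakly
increasing tuple of the differences of the other entries with the first one. -/
def monotoneConsEquiv (n : ℕ) :
    ℕ × {a : Fin n → ℕ // Monotone a} ≃ {a : Fin (n + 1) → ℕ // Monotone a} where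
  toFun p := ⟨Fin.cons p.1 fun j => p.1 + p.2.1 j, by
    intro i j hij
    induction i using Fin.cases with
    | zero => induction j using Fin.cases <;> simp
    | succ i =>
      induction j using Fin.cases with
      | zero => simp at hij
      | succ j => simpa using p.2.2 (Fin.succ_le_succ_iff.mp hij)⟩
  invFun a := ⟨a.1 0, fun j => a.1 j.succ - a.1 0, fun _ _ hij =>
    Nat.sub_le_sub_right (a.2 (Fin.succ_le_succ_iff.mpr hij)) _⟩
  left_inv p := by simp
  right_inv a := by
    ext j
    induction j using Fin.cases with
    | zero => simp
    | succ j => simpa using Nat.add_sub_cancel' (a.2 (Fin.zero_le j.succ))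

@[simp]
lemma monotoneConsEquiv_zero {n : ℕ} (p : ℕ × {a : Fin n → ℕ // Monotone a}) :
    (monotoneConsEquiv n p).1 0 = p.1 := rfl

@[simp]
lemma monotoneConsEquiv_succ {n : ℕ} (p : ℕ × {a : Fin n → ℕ // Monotone a}) (j : Fin n) :
    (monotoneConsEquiv n p).1 j.succ = p.1 + p.2.1 j := rfl

lemma sum_monotoneConsEquiv {n : ℕ} (p : ℕ × {a : Fin n → ℕ // Monotone a}) :
    ∑ j, (monotoneConsEquiv n p).1 j = (n + 1) * p.1 + ∑ j, p.2.1 j := by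
  simp [Fin.sum_univ_succ, Finset.sum_add_distrib]
  ring

lemma summable_pow_sum_monotone {r : ℝ} (hr0 : 0 ≤ r) (hr1 : r < 1) (n : ℕ) :
    Summable fun a : {a : Fin n → ℕ // Monotone a} => r ^ ∑ j, a.1 j := by
  induction n with
  | zero =>
    have : Finite {a : Fin 0 → ℕ // Monotone a} := Subtype.finite
    exact Summable.of_finite
  | succ n ih =>
    rw [← (monotoneConsEquiv n).summable_iff]
    have h : Summable fun s : ℕ => (r ^ (n + 1)) ^ s :=
      summable_geometric_of_lt_one (by positivity) (pow_lt_one₀ hr0 hr1 n.succ_ne_zero)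
    refine (h.mul_of_nonneg ih (fun s => by positivity) (fun a => by positivity)).congr
      fun p => ?_
    simp only [Function.comp_apply, sum_monotoneConsEquiv, pow_add, pow_mul]

lemma eps5_zero {n : ℕ} (a : Fin (n + 1) → ℕ) : eps5 a 0 = if a 0 = 0 then 1 else 0 := by
  simp [eps5]

lemma eps5_monotoneConsEquiv_succ {n : ℕ} (p : ℕ × {a : Fin n → ℕ // Monotone a}) (j : Fin n) :
    eps5 (monotoneConsEquiv n p).1 j.succ = eps5 p.2.1 j := by
  obtain ⟨j, hj⟩ := j
  cases j with
  | zero =>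
    have h : (monotoneConsEquiv n p).1 ⟨1, by omega⟩ = p.1 + p.2.1 ⟨0, hj⟩ := rfl
    simp [eps5, h]
  | succ j =>
    have h : (monotoneConsEquiv n p).1 ⟨j + 1, by omega⟩ = p.1 + p.2.1 ⟨j, by omega⟩ := rfl
    have h' : (monotoneConsEquiv n p).1 ⟨j + 1 + 1, by omega⟩ = p.1 + p.2.1 ⟨j + 1, hj⟩ := rfl
    simp [eps5, h, h']

lemma exponent_pos {m n : ℕ} (hm : 0 < m) (a : Fin n → ℕ) (j : Fin n) {k : ℕ}
    (hk : eps5 a j ≤ k) : 0 < (j : ℕ) * m + k + a j := by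
  by_contra! h
  have hj : (j : ℕ) = 0 := by
    by_contra hj
    have := Nat.mul_pos (Nat.pos_of_ne_zero hj) hm
    omega
  have ha : a j = 0 := by omega
  simp [eps5, hj, ha] at hk
  omega

/-- The summand indexed by the weakly increasing tuple `a`. -/
noncomputable def monotoneTerm (q b : ℂ) (m : ℕ) {n : ℕ} (a : Fin n → ℕ) : ℂ :=
  q ^ (m * ∑ j, a j) /
    ∏ j : Fin n, ∏ k ∈ Finset.Icc (eps5 a j) m, (1 + b * q ^ ((j : ℕ) * m + k + a j))

lemma summable_monotoneTerm {q : ℂ} (hq1 : ‖q‖ < 1) (b : ℂ) {m : ℕ} (hm : 0 < m) (n : ℕ) :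
    Summable fun a : {a : Fin n → ℕ // Monotone a} => monotoneTerm q b m a.1 := by
  obtain ⟨B, hB1, hB⟩ := exists_norm_inv_one_add_mul_pow_le hq1 b
  have hr := summable_pow_sum_monotone (r := ‖q‖ ^ m) (by positivity)
    (pow_lt_one₀ (norm_nonneg q) hq1 hm.ne') n
  refine Summable.of_norm_bounded (hr.mul_right ((B ^ (m + 1)) ^ n)) fun a => ?_
  rw [monotoneTerm, div_eq_mul_inv, norm_mul, norm_pow, pow_mul]
  refine mul_le_mul_of_nonneg_left ?_ (by positivity)
  rw [← Finset.prod_inv_distrib, norm_prod]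
  refine (Finset.prod_le_prod (fun _ _ => norm_nonneg _) (g := fun _ => B ^ (m + 1))
    fun j _ => ?_).trans_eq (by simp)
  rw [← Finset.prod_inv_distrib, norm_prod]
  refine (Finset.prod_le_prod (fun _ _ => norm_nonneg _) (g := fun _ => B) fun k hk =>
    hB _ (exponent_pos hm _ _ (Finset.mem_Icc.mp hk).1)).trans ?_
  rw [Finset.prod_const]
  exact pow_le_pow_right₀ hB1 (by simp)

lemma qPoch_add (a q : ℂ) (M N : ℕ) :
    qPoch a q (M + N) = qPoch a q M * qPoch (a * q ^ M) q N := by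
  simp only [qPoch, Finset.prod_range_add, pow_add, mul_assoc]

lemma qPoch_one (a q : ℂ) : qPoch a q 1 = 1 - a := by simp [qPoch]

lemma qPoch_shift_ne_zero {q b : ℂ} (hb : ∀ N : ℕ, 0 < N → 1 + b * q ^ N ≠ 0) (s M : ℕ) :
    qPoch (-(b * q ^ s * q)) q M ≠ 0 := by
  refine Finset.prod_ne_zero_iff.mpr fun j _ => ?_
  convert hb (s + 1 + j) (by omega) using 1
  ring

/-- The first block of factors, with the factor `k = 0` left out when the first entry vanishes. -/
lemma prod_Icc_first (q b : ℂ) (m s : ℕ) :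
    ∏ k ∈ Finset.Icc (if s = 0 then 1 else 0) m, (1 + b * q ^ (k + s)) =
      (if s = 0 then 1 else 1 + b * q ^ s) * qPoch (-(b * q ^ s * q)) q m := by
  have h : ∏ k ∈ Finset.Icc 1 m, (1 + b * q ^ (k + s)) = qPoch (-(b * q ^ s * q)) q m := by
    rw [← Finset.Ico_add_one_right_eq_Icc, Finset.prod_Ico_eq_prod_range]
    refine Finset.prod_congr (by simp) fun j _ => ?_
    ring
  split_ifs with hs
  · rw [h, one_mul]
  · rw [← h, ← Finset.mul_prod_Ioc_eq_prod_Icc (Nat.zero_le m), zero_add]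
    rfl

lemma monotoneTerm_monotoneConsEquiv (q b : ℂ) (m : ℕ) {n : ℕ}
    (p : ℕ × {a : Fin n → ℕ // Monotone a}) :
    monotoneTerm q b m (monotoneConsEquiv n p).1 =
      q ^ (m * (n + 1) * p.1) / ((if p.1 = 0 then 1 else 1 + b * q ^ p.1) *
        qPoch (-(b * q ^ p.1 * q)) q m) * monotoneTerm q (b * q ^ (p.1 + m)) m p.2.1 := by
  have h (j : Fin n) (k : ℕ) : b * q ^ ((j.succ : ℕ) * m + k + (p.1 + p.2.1 j)) =
      b * q ^ (p.1 + m) * q ^ ((j : ℕ) * m + k + p.2.1 j) := by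
    rw [mul_assoc, ← pow_add, Fin.val_succ]
    congr 2
    ring
  rw [monotoneTerm, monotoneTerm, sum_monotoneConsEquiv, Fin.prod_univ_succ, div_mul_div_comm,
    ← pow_add]
  simp only [eps5_monotoneConsEquiv_succ, eps5_zero, monotoneConsEquiv_zero,
    monotoneConsEquiv_succ, h, Fin.val_zero, zero_mul, zero_add]
  congr 2
  · ring
  · exact prod_Icc_first q b m p.1

lemma sum_range_telescope {q b : ℂ} (hb : ∀ N : ℕ, 0 < N → 1 + b * q ^ N ≠ 0) {M : ℕ}
    (hM : 1 - q ^ M ≠ 0) (N : ℕ) :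
    ∑ s ∈ Finset.range (N + 1), q ^ (M * s) /
        ((if s = 0 then 1 else 1 + b * q ^ s) * qPoch (-(b * q ^ s * q)) q M) =
      (1 / qPoch (-(b * q)) q M - (q ^ M) ^ (N + 1) / qPoch (-(b * q ^ N * q)) q M) /
        (1 - q ^ M) := by
  induction N with
  | zero =>
    have := qPoch_shift_ne_zero hb 0 M
    simp only [pow_zero, mul_one] at this
    simp
    field_simp
  | succ N ih =>
    rw [Finset.sum_range_succ, ih, if_neg N.succ_ne_zero, pow_mul]
    have h0 := qPoch_shift_ne_zero hb 0 M
    simp only [pow_zero, mul_one] at h0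
    have h1 := qPoch_shift_ne_zero hb N M
    have h2 := qPoch_shift_ne_zero hb (N + 1) M
    have h3 := hb (N + 1) N.succ_pos
    have h : qPoch (-(b * q ^ N * q)) q M * (1 + b * q ^ (N + 1) * q ^ M) =
        (1 + b * q ^ (N + 1)) * qPoch (-(b * q ^ (N + 1) * q)) q M := by
      have e := (qPoch_add (-(b * q ^ N * q)) q M 1).symm.trans
        ((congrArg _ (add_comm M 1)).trans (qPoch_add (-(b * q ^ N * q)) q 1 M))
      rw [qPoch_one, qPoch_one, pow_one] at e
      convert e using 2 <;> ring_nf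
    have h4 : 1 + b * q ^ (N + 1) * q ^ M ≠ 0 := by
      rw [mul_assoc, ← pow_add]
      exact hb _ (by omega)
    rw [eq_div_of_mul_eq h4 h]
    field_simp
    ring

open Filter Topology in
lemma tendsto_sum_range_telescope {q b : ℂ} (hq1 : ‖q‖ < 1)
    (hb : ∀ N : ℕ, 0 < N → 1 + b * q ^ N ≠ 0) {M : ℕ} (hM : 0 < M) :
    Tendsto (fun N => ∑ s ∈ Finset.range N, q ^ (M * s) /
        ((if s = 0 then 1 else 1 + b * q ^ s) * qPoch (-(b * q ^ s * q)) q M)) atTop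
      (𝓝 (1 / ((1 - q ^ M) * qPoch (-(b * q)) q M))) := by
  have hqM : ‖q ^ M‖ < 1 := by
    rw [norm_pow]
    exact pow_lt_one₀ (norm_nonneg q) hq1 hM.ne'
  have hM1 : 1 - q ^ M ≠ 0 := fun h => by
    rw [← sub_eq_zero.mp h] at hqM
    simp at hqM
  rw [← tendsto_add_atTop_iff_nat 1]
  simp only [sum_range_telescope hb hM1]
  have hden : Tendsto (fun N : ℕ => qPoch (-(b * q ^ N * q)) q M) atTop (𝓝 1) := by
    have hfac (j : ℕ) :
        Tendsto (fun N : ℕ => 1 - -(b * q ^ N * q) * q ^ j) atTop (𝓝 1) := by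
      have h := (tendsto_pow_atTop_nhds_zero_of_norm_lt_one hq1).const_mul b
      simpa using ((h.mul_const q).neg.mul_const (q ^ j)).const_sub 1
    simpa [qPoch] using tendsto_finsetProd (Finset.range M) fun j _ => hfac j
  have hnum := (tendsto_pow_atTop_nhds_zero_of_norm_lt_one hqM).comp (tendsto_add_atTop_nat 1)
  have h := ((hnum.div hden one_ne_zero).const_sub
    (1 / qPoch (-(b * q)) q M)).div_const (1 - q ^ M)
  rw [div_one, sub_zero, div_div, mul_comm (qPoch _ _ _)] at h
  exact h

lemma tsum_monotoneTerm {q : ℂ} (hq1 : ‖q‖ < 1) {m : ℕ} (hm : 0 < m) (n : ℕ) :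
    ∀ b : ℂ, (∀ N : ℕ, 0 < N → 1 + b * q ^ N ≠ 0) →
      ∑' a : {a : Fin n → ℕ // Monotone a}, monotoneTerm q b m a.1 =
        1 / (qPoch (q ^ m) (q ^ m) n * qPoch (-(b * q)) q (m * n)) := by
  induction n with
  | zero =>
    intro b _
    have : Unique {a : Fin 0 → ℕ // Monotone a} :=
      ⟨⟨⟨Fin.elim0, fun i => i.elim0⟩⟩, fun a => Subtype.ext (Subsingleton.elim _ _)⟩
    simp [tsum_fintype, monotoneTerm, qPoch]
  | succ n ih =>
    intro b hb
    have hb' (s N : ℕ) (hN : 0 < N) : 1 + b * q ^ (s + m) * q ^ N ≠ 0 := by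
      rw [mul_assoc, ← pow_add]
      exact hb _ (by omega)
    rw [← (monotoneConsEquiv n).tsum_eq]
    have hsum := ((monotoneConsEquiv n).summable_iff.mpr
      (summable_monotoneTerm hq1 b hm (n + 1))).hasSum
    have hfib := hsum.prod_fiberwise (g := fun s => 1 / qPoch (q ^ m) (q ^ m) n *
        (q ^ (m * (n + 1) * s) / ((if s = 0 then 1 else 1 + b * q ^ s) *
          qPoch (-(b * q ^ s * q)) q (m * (n + 1))))) fun s => by
      have h := (summable_monotoneTerm hq1 (b * q ^ (s + m)) hm n).hasSum.mul_left
        (q ^ (m * (n + 1) * s) / ((if s = 0 then 1 else 1 + b * q ^ s) *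
          qPoch (-(b * q ^ s * q)) q m))
      simp only [Function.comp_apply, monotoneTerm_monotoneConsEquiv]
      refine (congrArg (HasSum _) ?_).mp h
      rw [ih _ (hb' s), mul_add m n 1, mul_one, add_comm (m * n) m, qPoch_add,
        show -(b * q ^ (s + m) * q) = -(b * q ^ s * q) * q ^ m by ring,
        div_mul_div_comm, div_mul_div_comm]
      congr 1 <;> ring
    refine tendsto_nhds_unique hfib.tendsto_sum_nat ?_
    simp only [← Finset.mul_sum]
    convert (tendsto_sum_range_telescope hq1 hb
      (Nat.mul_pos hm n.succ_pos)).const_mul (1 / qPoch (q ^ m) (q ^ m) n) using 2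
    have hstep : qPoch (q ^ m) (q ^ m) (n + 1) =
        qPoch (q ^ m) (q ^ m) n * (1 - q ^ (m * (n + 1))) := by
      rw [qPoch_add, qPoch_one]
      ring
    rw [hstep, div_mul_div_comm, one_mul, mul_assoc]

/-- Lemma 3.4: for `0 < |q| < 1`, `b` with `1 + b q^N ≠ 0` for all
positive integers `N`, and positive integers `m`, `n`, the sum over all weakly
increasing `n`-tuples `(a_1,…,a_n)` of nonnegative integers of
`q^{m(a_1+⋯+a_n)} / ∏_{j=1}^n ∏_{k=ε_j}^{m} (1 + b q^{(j-1)m+k+a_j})`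
converges absolutely and equals `1 / ((q^m; q^m)_n (−bq; q)_{mn})`. -/
theorem lemma_sum_three (q b : ℂ) (hq0 : 0 < ‖q‖) (hq1 : ‖q‖ < 1)
    (hb : ∀ N : ℕ, 0 < N → 1 + b * q ^ N ≠ 0) (m n : ℕ) (hm : 0 < m) (hn : 0 < n) :
    Summable (fun a : {a : Fin n → ℕ // Monotone a} =>
      q ^ (m * ∑ j, a.1 j) /
        ∏ j : Fin n, ∏ k ∈ Finset.Icc (eps5 a.1 j) m,
          (1 + b * q ^ ((j : ℕ) * m + k + a.1 j))) ∧
    ∑' a : {a : Fin n → ℕ // Monotone a},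
      q ^ (m * ∑ j, a.1 j) /
        ∏ j : Fin n, ∏ k ∈ Finset.Icc (eps5 a.1 j) m,
          (1 + b * q ^ ((j : ℕ) * m + k + a.1 j)) =
      1 / (qPoch (q ^ m) (q ^ m) n * qPoch (-(b * q)) q (m * n)) := by
  exact ⟨summable_monotoneTerm hq1 b hm n, tsum_monotoneTerm hq1 hm n b hb⟩
end

section
/- Let q be a complex number with |q| < 1 and let a, b be complex numbers with 1 + b q^N ≠ 0 for every positive integer N. Then ∑_{n=0}^{∞} (−a; q)_n b^n q^{n(n+1)/2} / (q; q)_n = (−bq; q)_∞ · ∑_{n=0}^{∞} (ab)^n q^{n²} / ((q; q)_n · (−bq; q)_n). -/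
/-- The infinite q-Pochhammer symbol `(a; q)_∞ = ∏_{j=0}^{∞} (1 - a q^j)`. -/
noncomputable def qPochInf (a q : ℂ) : ℂ := ∏' j : ℕ, (1 - a * q ^ j)

/-- The general term `z^n q^{n(n-1)/2} / (q; q)_n` of Euler's `q`-exponential series. -/
noncomputable def eulerTerm (q z : ℂ) (n : ℕ) : ℂ := z ^ n * q ^ n.choose 2 / qPoch q q n

theorem choose_two_succ (n : ℕ) : (n + 1).choose 2 = n.choose 2 + n := by
  rw [Nat.choose_succ_succ' n 1, Nat.choose_one_right, add_comm]

theorem choose_two_add_succ (k m : ℕ) :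
    (k + m + 1).choose 2 + k.choose 2 = k ^ 2 + m * k + m + m.choose 2 := by
  induction k with
  | zero => simp [choose_two_succ, add_comm]
  | succ k ih =>
    rw [show k + 1 + m + 1 = (k + m + 1) + 1 by ring, choose_two_succ (k + m + 1),
      choose_two_succ k]
    linear_combination ih

theorem sq_eq_choose_two_add (k : ℕ) : k ^ 2 = k.choose 2 + (k + 1).choose 2 := by
  have h := choose_two_add_succ k 0
  simp only [add_zero, zero_mul, Nat.choose_zero_succ] at h
  omega

theorem qPoch_zero (a q : ℂ) : qPoch a q 0 = 1 := by simp [qPoch]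

theorem qPoch_succ (a q : ℂ) (n : ℕ) : qPoch a q (n + 1) = qPoch a q n * (1 - a * q ^ n) :=
  Finset.prod_range_succ _ _

theorem one_sub_pow_succ_ne_zero {q : ℂ} (hq : ‖q‖ < 1) (n : ℕ) : 1 - q ^ (n + 1) ≠ 0 := by
  intro h
  have h1 : ‖q ^ (n + 1)‖ = 1 := by rw [← sub_eq_zero.mp h, norm_one]
  rw [norm_pow] at h1
  exact (pow_lt_one₀ (norm_nonneg q) hq n.succ_ne_zero).ne h1

theorem qPoch_self_ne_zero {q : ℂ} (hq : ‖q‖ < 1) (n : ℕ) : qPoch q q n ≠ 0 := by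
  refine Finset.prod_ne_zero_iff.mpr fun j _ => ?_
  rw [← pow_succ']
  exact one_sub_pow_succ_ne_zero hq j

theorem eulerTerm_succ {q : ℂ} (hq : ‖q‖ < 1) (z : ℂ) (n : ℕ) :
    eulerTerm q z (n + 1) = z * q ^ n / (1 - q ^ (n + 1)) * eulerTerm q z n := by
  have h1 := one_sub_pow_succ_ne_zero hq n
  have h2 := qPoch_self_ne_zero hq n
  rw [eulerTerm, eulerTerm, qPoch_succ, choose_two_succ, ← pow_succ']
  field_simp
  ring

theorem summable_norm_eulerTerm {q : ℂ} (hq : ‖q‖ < 1) (z : ℂ) :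
    Summable fun n => ‖eulerTerm q z n‖ := by
  have hpow := tendsto_pow_atTop_nhds_zero_of_norm_lt_one hq
  have hlim : Filter.Tendsto (fun n : ℕ => ‖z * q ^ n / (1 - q ^ (n + 1))‖) Filter.atTop
      (nhds 0) := by
    have h := ((hpow.const_mul z).div
      (((hpow.comp (Filter.tendsto_add_atTop_nat 1)).const_sub 1)) (by simp)).norm
    simpa using h
  refine summable_of_ratio_norm_eventually_le (r := 1 / 2) (by norm_num) ?_
  filter_upwards [hlim.eventually_le_const (show (0 : ℝ) < 1 / 2 by norm_num)] with n hn
  rw [norm_norm, norm_norm, eulerTerm_succ hq, norm_mul]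
  gcongr

theorem summable_eulerTerm {q : ℂ} (hq : ‖q‖ < 1) (z : ℂ) : Summable (eulerTerm q z) :=
  (summable_norm_eulerTerm hq z).of_norm

theorem eulerTerm_mul (q z w : ℂ) (n : ℕ) :
    eulerTerm q (z * w) n = w ^ n * eulerTerm q z n := by
  rw [eulerTerm, eulerTerm, mul_pow]
  ring

theorem tsum_eulerTerm_eq_mul {q : ℂ} (hq : ‖q‖ < 1) (z : ℂ) :
    ∑' n, eulerTerm q z n = (1 + z) * ∑' n, eulerTerm q (z * q) n := by
  have key : ∀ n, eulerTerm q z (n + 1) =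
      eulerTerm q (z * q) (n + 1) + z * eulerTerm q (z * q) n := by
    intro n
    have h1 := one_sub_pow_succ_ne_zero hq n
    rw [eulerTerm_mul, eulerTerm_mul, eulerTerm_succ hq]
    field_simp
    ring
  have hs := summable_eulerTerm hq (z * q)
  rw [(summable_eulerTerm hq z).tsum_eq_zero_add, tsum_congr key,
    ((summable_nat_add_iff 1).mpr hs).tsum_add (hs.mul_left z), tsum_mul_left,
    add_mul, one_mul, ← add_assoc]
  congr 1
  rw [hs.tsum_eq_zero_add]
  simp [eulerTerm]

theorem tsum_eulerTerm_eq_qPoch_mul {q : ℂ} (hq : ‖q‖ < 1) (z : ℂ) (N : ℕ) :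
    ∑' n, eulerTerm q z n = qPoch (-z) q N * ∑' n, eulerTerm q (z * q ^ N) n := by
  induction N with
  | zero => simp [qPoch_zero]
  | succ N ih =>
    rw [ih, tsum_eulerTerm_eq_mul hq (z * q ^ N), qPoch_succ, pow_succ, mul_assoc z]
    ring

theorem tendsto_qPoch {q : ℂ} (hq : ‖q‖ < 1) (a : ℂ) :
    Filter.Tendsto (qPoch a q) Filter.atTop (nhds (qPochInf a q)) := by
  have hs : Summable fun j : ℕ => ‖-(a * q ^ j)‖ := by
    simp only [norm_neg, norm_mul, norm_pow]
    exact (summable_geometric_of_lt_one (norm_nonneg q) hq).mul_left _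
  have h := (multipliable_one_add_of_summable hs).hasProd.tendsto_prod_nat
  simp only [← sub_eq_add_neg] at h
  exact h

/-- Euler's expansion of the infinite product `(-z; q)_∞`. -/
theorem tsum_eulerTerm {q : ℂ} (hq : ‖q‖ < 1) (z : ℂ) :
    ∑' n, eulerTerm q z n = qPochInf (-z) q := by
  have hlim : Filter.Tendsto (fun N : ℕ => ∑' n, eulerTerm q (z * q ^ N) n) Filter.atTop
      (nhds (∑' n, eulerTerm q (z * 0) n)) := by
    refine tendsto_tsum_of_dominated_convergence (summable_norm_eulerTerm hq z) (fun n => ?_)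
      (Filter.Eventually.of_forall fun N n => ?_)
    · simp only [eulerTerm_mul]
      exact ((tendsto_pow_atTop_nhds_zero_of_norm_lt_one hq).pow n).mul_const _
    · rw [eulerTerm_mul, norm_mul, norm_pow, norm_pow]
      exact mul_le_of_le_one_left (norm_nonneg _)
        (pow_le_one₀ (by positivity) (pow_le_one₀ (norm_nonneg q) hq.le))
  have h0 : ∑' n, eulerTerm q (z * 0) n = 1 := by
    rw [tsum_eq_single 0 fun n hn => by simp [eulerTerm, hn]]
    simp [eulerTerm, qPoch_zero]
  have h := (tendsto_qPoch hq (-z)).mul hlim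
  simp only [← tsum_eulerTerm_eq_qPoch_mul hq z, h0, mul_one] at h
  exact tendsto_nhds_unique tendsto_const_nhds h

theorem qPochInf_eq_qPoch_mul {q : ℂ} (hq : ‖q‖ < 1) (z : ℂ) (N : ℕ) :
    qPochInf (-z) q = qPoch (-z) q N * qPochInf (-(z * q ^ N)) q := by
  rw [← tsum_eulerTerm hq, ← tsum_eulerTerm hq, tsum_eulerTerm_eq_qPoch_mul hq z N]

/-- The finite `q`-binomial theorem, divided by `(q; q)_n`. -/
theorem qPoch_div_eq_sum_antidiagonal {q : ℂ} (hq : ‖q‖ < 1) (a : ℂ) (n : ℕ) :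
    qPoch (-a) q n / qPoch q q n =
      ∑ p ∈ Finset.HasAntidiagonal.antidiagonal n, eulerTerm q a p.1 / qPoch q q p.2 := by
  induction n with
  | zero => simp [qPoch_zero, eulerTerm]
  | succ n ih =>
    have h1 := one_sub_pow_succ_ne_zero hq n
    rw [qPoch_succ, qPoch_succ, ← pow_succ', mul_div_mul_comm, ih, ← mul_div_assoc,
      div_eq_iff h1]
    have hsplit : (∑ p ∈ Finset.HasAntidiagonal.antidiagonal (n + 1),
          eulerTerm q a p.1 / qPoch q q p.2) *
          (1 - q ^ (n + 1)) =
        (∑ p ∈ Finset.HasAntidiagonal.antidiagonal (n + 1),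
          (1 - q ^ p.2) * (eulerTerm q a p.1 / qPoch q q p.2)) +
        ∑ p ∈ Finset.HasAntidiagonal.antidiagonal (n + 1),
          q ^ p.2 * (1 - q ^ p.1) * (eulerTerm q a p.1 / qPoch q q p.2) := by
      rw [Finset.sum_mul, ← Finset.sum_add_distrib]
      refine Finset.sum_congr rfl fun p hp => ?_
      rw [← Finset.HasAntidiagonal.mem_antidiagonal.mp hp, pow_add]
      ring
    rw [hsplit, Finset.Nat.sum_antidiagonal_succ', Finset.Nat.sum_antidiagonal_succ,
      Finset.sum_mul]
    simp only [pow_zero, sub_self, zero_mul, mul_zero, zero_add]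
    rw [← Finset.sum_add_distrib]
    refine Finset.sum_congr rfl fun p hp => ?_
    have h2 := one_sub_pow_succ_ne_zero hq p.1
    have h3 := one_sub_pow_succ_ne_zero hq p.2
    have h4 := qPoch_self_ne_zero hq p.2
    rw [eulerTerm_succ hq, qPoch_succ, ← pow_succ',
      ← Finset.HasAntidiagonal.mem_antidiagonal.mp hp]
    field_simp
    ring

/-- Theorem 4.1: for `|q| < 1` and `a`, `b` with `1 + b q^N ≠ 0`
for all positive integers `N`,
`∑_{n≥0} (−a; q)_n b^n q^{n(n+1)/2}/(q; q)_n
  = (−bq; q)_∞ ∑_{n≥0} (ab)^n q^{n²}/((q; q)_n (−bq; q)_n)`. -/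
theorem entry_1_6_1 (q a b : ℂ) (hq : ‖q‖ < 1)
    (hb : ∀ N : ℕ, 0 < N → 1 + b * q ^ N ≠ 0) :
    ∑' n : ℕ, qPoch (-a) q n * b ^ n * q ^ (n * (n + 1) / 2) / qPoch q q n =
      qPochInf (-(b * q)) q *
        ∑' n : ℕ, (a * b) ^ n * q ^ (n ^ 2) / (qPoch q q n * qPoch (-(b * q)) q n) := by
  set f : ℕ × ℕ → ℂ := fun p =>
    eulerTerm q a p.1 / qPoch q q p.2 * (b ^ (p.1 + p.2) * q ^ (p.1 + p.2 + 1).choose 2) with hf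
  have hfac : ∀ k m, f (k, m) =
      q ^ (k + 1).choose 2 * eulerTerm q (a * b) k * eulerTerm q (b * q * q ^ k) m := by
    intro k m
    have hexp : q ^ (k + m + 1).choose 2 * q ^ k.choose 2 =
        q ^ k.choose 2 * q ^ (k + 1).choose 2 * (q ^ k) ^ m * q ^ m * q ^ m.choose 2 := by
      rw [← pow_add, choose_two_add_succ, sq_eq_choose_two_add]
      ring
    simp only [hf, eulerTerm, mul_pow, pow_add b]
    linear_combination (a ^ k * b ^ k * b ^ m / (qPoch q q k * qPoch q q m)) * hexp
  have hsum : Summable f := by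
    refine Summable.of_norm_bounded ((summable_norm_eulerTerm hq (a * b)).mul_of_nonneg
      (summable_norm_eulerTerm hq (b * q)) (fun _ => norm_nonneg _) (fun _ => norm_nonneg _)) ?_
    rintro ⟨k, m⟩
    rw [hfac, eulerTerm_mul q (b * q), norm_mul, norm_mul, norm_mul, norm_pow, norm_pow, norm_pow]
    have h1 : ‖q‖ ^ (k + 1).choose 2 ≤ 1 := pow_le_one₀ (norm_nonneg q) hq.le
    have h2 : (‖q‖ ^ k) ^ m ≤ 1 :=
      pow_le_one₀ (by positivity) (pow_le_one₀ (norm_nonneg q) hq.le)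
    exact mul_le_mul (mul_le_of_le_one_left (norm_nonneg _) h1)
      (mul_le_of_le_one_left (norm_nonneg _) h2) (by positivity) (norm_nonneg _)
  have hne : ∀ n, qPoch (-(b * q)) q n ≠ 0 := fun n =>
    Finset.prod_ne_zero_iff.mpr fun j _ => by
      have h := hb (j + 1) j.succ_pos
      rwa [pow_succ', ← mul_assoc, ← sub_neg_eq_add, ← neg_mul] at h
  have hleft : ∑' n : ℕ, qPoch (-a) q n * b ^ n * q ^ (n * (n + 1) / 2) / qPoch q q n =
      ∑' p, f p := by
    have hsig := (Finset.HasAntidiagonal.sigmaAntidiagonalEquivProd.summable_iff (f := f)).mpr hsum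
    rw [← Finset.HasAntidiagonal.sigmaAntidiagonalEquivProd.tsum_eq f]
    refine Eq.trans ?_ (hsig.tsum_sigma' fun n => (hasSum_fintype _).summable).symm
    refine tsum_congr fun n => ?_
    refine Eq.trans ?_ ((tsum_fintype _).trans
      (Finset.sum_coe_sort (Finset.HasAntidiagonal.antidiagonal n) f)).symm
    have hn : qPoch (-a) q n * b ^ n * q ^ (n * (n + 1) / 2) / qPoch q q n =
        qPoch (-a) q n / qPoch q q n * (b ^ n * q ^ (n + 1).choose 2) := by
      rw [Nat.choose_two_right, Nat.add_sub_cancel, mul_comm (n + 1)]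
      ring
    rw [hn, qPoch_div_eq_sum_antidiagonal hq, Finset.sum_mul]
    refine Finset.sum_congr rfl fun p hp => ?_
    rw [← Finset.HasAntidiagonal.mem_antidiagonal.mp hp]
  rw [hleft, hsum.tsum_prod, ← tsum_mul_left]
  refine tsum_congr fun k => ?_
  simp only [hfac]
  rw [tsum_mul_left, tsum_eulerTerm hq, qPochInf_eq_qPoch_mul hq (b * q) k, eulerTerm,
    sq_eq_choose_two_add, pow_add]
  have h1 := hne k
  have h2 := qPoch_self_ne_zero hq k
  field_simp
end
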